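/- Let T² ∈ ℝ with T² ≠ 0, and consider on the half-plane U = {(x¹,x²) ∈ ℝ² : x¹ > 0} the Type B connection with Christoffel symbols Γ_{12}² = T²/x¹, Γ_{21}² = −T²/x¹, and all other Γ_{ij}^k = 0 (the model N₀⁶(0,T²)). Then a smooth vector field X on U is an affine Killing vector field for this connection if and only if X lies in the ℝ-linear span of the four vector fields (x¹, x²), (0,1), (0, x¹), and (0, x²). -/

import Mathlib

open Real

/-- The partial derivative `∂f/∂x^i` of a function on `ℝ²` (points are `Fin 2 → ℝ`). -/
noncomputable def pd (f : (Fin 2 → ℝ) → ℝ) (i : Fin 2) (p : Fin 2 → ℝ) : ℝ :=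
  fderiv ℝ f p (Pi.single i 1)

/-- The affine Killing operator
`K^Γ_{ij}^k(v) = ∂_i∂_j v^k + v^l ∂_l Γ_{ij}^k − Γ_{ij}^l ∂_l v^k + Γ_{il}^k ∂_j v^l + Γ_{lj}^k ∂_i v^l`
(summation over `l`). -/
noncomputable def killingOp (Γ : Fin 2 → Fin 2 → Fin 2 → (Fin 2 → ℝ) → ℝ)
    (v : Fin 2 → (Fin 2 → ℝ) → ℝ) (i j k : Fin 2) (p : Fin 2 → ℝ) : ℝ :=
  pd (fun q => pd (v k) j q) i p
    + (∑ l : Fin 2, v l p * pd (Γ i j k) l p)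
    - (∑ l : Fin 2, Γ i j l p * pd (v k) l p)
    + (∑ l : Fin 2, Γ i l k p * pd (v l) j p)
    + (∑ l : Fin 2, Γ l j k p * pd (v l) i p)

/-- `v` is an affine Killing vector field for the connection `Γ` on `U`:
all eight affine Killing equations hold on `U`. -/
def IsAffineKilling (U : Set (Fin 2 → ℝ))
    (Γ : Fin 2 → Fin 2 → Fin 2 → (Fin 2 → ℝ) → ℝ)
    (v : Fin 2 → (Fin 2 → ℝ) → ℝ) : Prop :=
  ∀ i j k : Fin 2, ∀ p ∈ U, killingOp Γ v i j k p = 0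

/-- The open right half-plane. -/
abbrev halfPlane : Set (Fin 2 → ℝ) := {p : Fin 2 → ℝ | 0 < p 0}

lemma isOpen_halfPlane : IsOpen halfPlane :=
  isOpen_lt continuous_const (continuous_apply 0)

lemma convex_halfPlane : Convex ℝ halfPlane :=
  convex_halfSpace_gt (LinearMap.proj (R := ℝ) (φ := fun _ : Fin 2 => ℝ) 0).isLinear 0

lemma pd_congr {f g : (Fin 2 → ℝ) → ℝ} {U : Set (Fin 2 → ℝ)} (hU : IsOpen U)
    (h : Set.EqOn f g U) (i : Fin 2) : Set.EqOn (pd f i) (pd g i) U := fun p hp => by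
  unfold pd
  rw [(h.eventuallyEq_of_mem (hU.mem_nhds hp)).fderiv_eq]

lemma pd_const (c : ℝ) (i : Fin 2) (p : Fin 2 → ℝ) : pd (fun _ => c) i p = 0 := by
  simp [pd]

/-- The partial derivatives of an affine function are its coefficients. -/
lemma pd_affine (c : ℝ) (α : Fin 2 → ℝ) (i : Fin 2) (p : Fin 2 → ℝ) :
    pd (fun q => c + α 0 * q 0 + α 1 * q 1) i p = α i := by
  have h (k : Fin 2) : HasFDerivAt (fun q : Fin 2 → ℝ => q k)
      (ContinuousLinearMap.proj (R := ℝ) (φ := fun _ : Fin 2 => ℝ) k) p :=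
    hasFDerivAt_apply k p
  unfold pd
  rw [((((h 0).const_mul (α 0)).const_add c).fun_add ((h 1).const_mul (α 1))).fderiv]
  fin_cases i <;> simp

lemma pd_const_div (A : ℝ) (i : Fin 2) {p : Fin 2 → ℝ} (hp : p 0 ≠ 0) :
    pd (fun q => A / q 0) i p = if i = 0 then -A / p 0 ^ 2 else 0 := by
  have h : HasFDerivAt (fun q : Fin 2 → ℝ => q 0)
      (ContinuousLinearMap.proj (R := ℝ) (φ := fun _ : Fin 2 => ℝ) 0) p :=
    hasFDerivAt_apply 0 p
  have h' := ((hasDerivAt_inv hp).const_mul A).comp_hasFDerivAt p h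
  have e : (fun q : Fin 2 → ℝ => A / q 0) = (fun y => A * y⁻¹) ∘ fun q : Fin 2 → ℝ => q 0 := by
    ext q; simp [div_eq_mul_inv]
  unfold pd
  rw [e, h'.fderiv]
  fin_cases i <;> simp [div_eq_mul_inv]

lemma fderiv_eq_zero_of_pd {f : (Fin 2 → ℝ) → ℝ} {p : Fin 2 → ℝ}
    (h : ∀ i, pd f i p = 0) : fderiv ℝ f p = 0 := by
  ext w
  have hw : w = w 0 • Pi.single 0 1 + w 1 • Pi.single 1 1 := by
    ext i; fin_cases i <;> simp
  have h0 : fderiv ℝ f p (Pi.single 0 1) = 0 := h 0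
  have h1 : fderiv ℝ f p (Pi.single 1 1) = 0 := h 1
  rw [hw, map_add, map_smul, map_smul, h0, h1]
  simp

lemma exists_const_of_pd_eq_zero {f : (Fin 2 → ℝ) → ℝ} (hf : DifferentiableOn ℝ f halfPlane)
    (h : ∀ i, ∀ p ∈ halfPlane, pd f i p = 0) : ∃ c, ∀ p ∈ halfPlane, f p = c :=
  isOpen_halfPlane.exists_is_const_of_fderiv_eq_zero convex_halfPlane.isPreconnected hf
    fun p hp => fderiv_eq_zero_of_pd fun i => h i p hp

lemma contDiffOn_pd {f : (Fin 2 → ℝ) → ℝ} (hf : ContDiffOn ℝ (⊤ : ℕ∞) f halfPlane)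
    (i : Fin 2) : ContDiffOn ℝ (⊤ : ℕ∞) (pd f i) halfPlane :=
  (hf.fderiv_of_isOpen isOpen_halfPlane (by simp)).clm_apply contDiffOn_const

lemma pd_comm {f : (Fin 2 → ℝ) → ℝ} (hf : ContDiffOn ℝ (⊤ : ℕ∞) f halfPlane)
    (i j : Fin 2) {p : Fin 2 → ℝ} (hp : p ∈ halfPlane) :
    pd (pd f j) i p = pd (pd f i) j p := by
  have hd : DifferentiableAt ℝ (fderiv ℝ f) p :=
    ((hf.fderiv_of_isOpen isOpen_halfPlane (m := 1) (by norm_cast)).differentiableOn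
      one_ne_zero).differentiableAt (isOpen_halfPlane.mem_nhds hp)
  have key (i j : Fin 2) : pd (pd f j) i p =
      fderiv ℝ (fderiv ℝ f) p (Pi.single i 1) (Pi.single j 1) := by
    change fderiv ℝ (fun q => fderiv ℝ f q (Pi.single j 1)) p (Pi.single i 1) = _
    rw [fderiv_clm_apply hd (differentiableAt_const _)]
    simp
  rw [key, key]
  exact ((hf.contDiffAt (isOpen_halfPlane.mem_nhds hp)).isSymmSndFDerivAt
    (by simpa using WithTop.coe_le_coe.2 (le_top (a := (2 : ℕ∞))))).eq _ _

/-- A smooth function on the half-plane with vanishing second derivatives is affine. -/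
lemma exists_affine_of_pd_pd_eq_zero {f : (Fin 2 → ℝ) → ℝ}
    (hf : ContDiffOn ℝ (⊤ : ℕ∞) f halfPlane)
    (h : ∀ i j, ∀ p ∈ halfPlane, pd (pd f j) i p = 0) :
    ∃ (c : ℝ) (α : Fin 2 → ℝ), ∀ p ∈ halfPlane, f p = c + α 0 * p 0 + α 1 * p 1 := by
  have hpd (j : Fin 2) : ∃ c, ∀ p ∈ halfPlane, pd f j p = c :=
    exists_const_of_pd_eq_zero ((contDiffOn_pd hf j).differentiableOn (by simp))
      fun i => h i j
  choose α hα using hpd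
  have hfd : DifferentiableOn ℝ f halfPlane := hf.differentiableOn (by simp)
  have hl : Differentiable ℝ fun q : Fin 2 → ℝ => 0 + α 0 * q 0 + α 1 * q 1 := by fun_prop
  obtain ⟨c, hc⟩ := exists_const_of_pd_eq_zero (hfd.sub hl.differentiableOn) fun i p hp => by
    have hfp := hfd.differentiableAt (isOpen_halfPlane.mem_nhds hp)
    have h1 := hα i p hp
    have h2 := pd_affine 0 α i p
    unfold pd at h1 h2 ⊢
    rw [fderiv_sub hfp (hl p), sub_apply, h1, h2, sub_self]
  exact ⟨c, α, fun p hp => by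
    have := hc p hp
    simp only [Pi.sub_apply] at this
    linarith⟩

lemma pd_pd_eq_zero_of_eqOn_affine {f : (Fin 2 → ℝ) → ℝ} {c : ℝ} {α : Fin 2 → ℝ}
    (h : Set.EqOn f (fun q => c + α 0 * q 0 + α 1 * q 1) halfPlane) (i j : Fin 2)
    {p : Fin 2 → ℝ} (hp : p ∈ halfPlane) : pd (pd f j) i p = 0 := by
  have hj : Set.EqOn (pd f j) (fun _ => α j) halfPlane := fun q hq =>
    (pd_congr isOpen_halfPlane h j hq).trans (pd_affine c α j q)
  exact (pd_congr isOpen_halfPlane hj i hp).trans (pd_const _ _ _)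

/-- The affine Killing equations of the model written out. -/
lemma isAffineKilling_iff (T2 : ℝ) (v : Fin 2 → (Fin 2 → ℝ) → ℝ) :
    IsAffineKilling halfPlane
      (fun i j k => fun p : Fin 2 → ℝ =>
        ![![![(0 : ℝ), 0], ![0, T2]], ![![0, -T2], ![0, 0]]] i j k / p 0) v
    ↔ ∀ p ∈ halfPlane,
        (∀ k, pd (pd (v k) 0) 0 p = 0 ∧ pd (pd (v k) 1) 1 p = 0)
        ∧ pd (pd (v 0) 1) 0 p = T2 / p 0 * pd (v 0) 1 p
        ∧ pd (pd (v 0) 0) 1 p = -(T2 / p 0 * pd (v 0) 1 p)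
        ∧ pd (pd (v 1) 1) 0 p = T2 / p 0 ^ 2 * (v 0 p - p 0 * pd (v 0) 0 p)
        ∧ pd (pd (v 1) 0) 1 p = -(T2 / p 0 ^ 2 * (v 0 p - p 0 * pd (v 0) 0 p)) := by
  have swap : ∀ P : Fin 2 → Fin 2 → Fin 2 → (Fin 2 → ℝ) → Prop,
      (∀ i j k, ∀ p ∈ halfPlane, P i j k p) ↔ ∀ p ∈ halfPlane, ∀ i j k, P i j k p :=
    fun P => ⟨fun h p hp i j k => h i j k p hp, fun h i j k p hp => h p hp i j k⟩
  unfold IsAffineKilling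
  rw [swap]
  refine forall₂_congr fun p hp => ?_
  have hp0 : p 0 ≠ 0 := ne_of_gt hp
  have e : T2 / p 0 = T2 / p 0 ^ 2 * p 0 := by field_simp
  simp only [Fin.forall_fin_two, killingOp, pd_const_div _ _ hp0, Fin.sum_univ_two]
  simp only [Fin.isValue, Matrix.cons_val', Matrix.cons_val_zero, Matrix.cons_val_fin_one,
    Matrix.cons_val_one, zero_div, neg_div, if_true, one_ne_zero, if_false, e]
  constructor
  · rintro ⟨⟨⟨h1, h2⟩, h3, h4⟩, ⟨h5, h6⟩, h7, h8⟩
    refine ⟨⟨⟨?_, ?_⟩, ?_, ?_⟩, ?_, ?_, ?_, ?_⟩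
    · linear_combination h1
    · linear_combination h7
    · linear_combination h2
    · linear_combination h8
    · linear_combination h3
    · linear_combination h5
    · linear_combination h4
    · linear_combination h6
  · rintro ⟨⟨⟨h1, h7⟩, h2, h8⟩, h3, h5, h4, h6⟩
    refine ⟨⟨⟨?_, ?_⟩, ?_, ?_⟩, ⟨?_, ?_⟩, ?_, ?_⟩
    · linear_combination h1
    · linear_combination h2
    · linear_combination h3
    · linear_combination h4
    · linear_combination h5
    · linear_combination h6
    · linear_combination h7
    · linear_combination h8


theorem stmt15 (T2 : ℝ) (hT : T2 ≠ 0)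
    (v : Fin 2 → (Fin 2 → ℝ) → ℝ)
    (hv : ∀ i : Fin 2, ContDiffOn ℝ (⊤ : ℕ∞) (v i) {p : Fin 2 → ℝ | 0 < p 0}) :
    IsAffineKilling {p : Fin 2 → ℝ | 0 < p 0}
      (fun i j k => fun p : Fin 2 → ℝ =>
        ![![![(0 : ℝ), 0], ![0, T2]], ![![0, -T2], ![0, 0]]] i j k / p 0) v
    ↔ ∃ a b c d : ℝ, ∀ p ∈ {p : Fin 2 → ℝ | 0 < p 0},
        v 0 p = a * p 0
        ∧ v 1 p = a * p 1 + b + c * p 0 + d * p 1 := by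
  refine (isAffineKilling_iff T2 v).trans ⟨fun h => ?_, ?_⟩
  · have hv01 : ∀ p ∈ halfPlane, pd (v 0) 1 p = 0 := fun p hp => by
      obtain ⟨-, h1, h2, -⟩ := h p hp
      have hp0 : p 0 ≠ 0 := ne_of_gt hp
      have h3 : T2 / p 0 * pd (v 0) 1 p = 0 := by
        linarith [pd_comm (hv 0) 0 1 hp]
      exact (mul_eq_zero.1 h3).resolve_left (div_ne_zero hT hp0)
    have hv00 : ∀ p ∈ halfPlane, T2 / p 0 ^ 2 * (v 0 p - p 0 * pd (v 0) 0 p) = 0 :=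
      fun p hp => by
        obtain ⟨-, -, -, h1, h2⟩ := h p hp
        linarith [pd_comm (hv 1) 0 1 hp]
    have hpd : ∀ k i j, ∀ p ∈ halfPlane, pd (pd (v k) j) i p = 0 := fun k i j p hp => by
      obtain ⟨h0, h1, h2, h3, h4⟩ := h p hp
      rw [hv00 p hp] at h3 h4
      rw [hv01 p hp] at h1 h2
      fin_cases k <;> fin_cases i <;> fin_cases j <;> simp_all
    obtain ⟨c₀, α, hα⟩ := exists_affine_of_pd_pd_eq_zero (hv 0) (hpd 0)
    obtain ⟨c₁, β, hβ⟩ := exists_affine_of_pd_pd_eq_zero (hv 1) (hpd 1)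
    have hpdα (i : Fin 2) : ∀ p ∈ halfPlane, pd (v 0) i p = α i := fun p hp =>
      (pd_congr isOpen_halfPlane hα i hp).trans (pd_affine c₀ α i p)
    have hmem : (fun _ => 1 : Fin 2 → ℝ) ∈ halfPlane := one_pos (α := ℝ)
    have hα1 : α 1 = 0 := (hpdα 1 _ hmem).symm.trans (hv01 _ hmem)
    have hc₀ : c₀ = 0 := by
      have h1 := hv00 _ hmem
      rw [hpdα 0 _ hmem, hα _ hmem, hα1] at h1
      simpa [hT] using h1
    refine ⟨α 0, c₁, β 0, β 1 - α 0, fun p hp => ⟨?_, ?_⟩⟩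
    · rw [hα p hp, hα1, hc₀]; ring
    · rw [hβ p hp]; ring
  · rintro ⟨a, b, c, d, h⟩ p hp
    have h0 : Set.EqOn (v 0) (fun q => 0 + ![a, 0] 0 * q 0 + ![a, 0] 1 * q 1) halfPlane :=
      fun q hq => by simp [(h q hq).1]
    have h1 : Set.EqOn (v 1) (fun q => b + ![c, a + d] 0 * q 0 + ![c, a + d] 1 * q 1)
        halfPlane := fun q hq => by
      simp only [(h q hq).2, Matrix.cons_val_zero, Matrix.cons_val_one]
      ring
    have hpd0 (i j : Fin 2) := pd_pd_eq_zero_of_eqOn_affine h0 i j hp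
    have hpd1 (i j : Fin 2) := pd_pd_eq_zero_of_eqOn_affine h1 i j hp
    have hx : pd (v 0) 0 p = a := (pd_congr isOpen_halfPlane h0 0 hp).trans (pd_affine _ _ _ _)
    have hy : pd (v 0) 1 p = 0 := (pd_congr isOpen_halfPlane h0 1 hp).trans (pd_affine _ _ _ _)
    simp [Fin.forall_fin_two, hpd0, hpd1, hx, hy, (h p hp).1, mul_comm]
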